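/- arXiv:2605.13582 — 2 statements merged into one kernel-verified Lean document; each statement's English description precedes it below -/
import Mathlib

section
/- (Property (M3): bounds on the blocks of the inverse matrix.) There exists a constant C > 0 such that for every m_0 ≠ 0, every r > 0 and every i ∈ {1,2}, the matrix A_{m_0}(r) is invertible and, writing the (i,j)-block of A_{m_0}(r)^{-1} as a_{ij} Id_d with a_{ij} ∈ ℝ, one has |a_{i1}| ≤ C (1 + |m_0|^{-1}) r^{-3} and |a_{i2}| ≤ C (1 + |m_0|) r^{-1}. -/
open MeasureTheory Real ENNReal
open scoped RealInnerProductSpace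

noncomputable section

/-- Euclidean space `ℝ^d`. -/
abbrev V (d : ℕ) : Type := EuclideanSpace ℝ (Fin d)

/-- The kinetic phase space `ℝ^{1+2d}`, with points `(t, x, v)`. -/
abbrev Pt (d : ℕ) : Type := ℝ × V d × V d

/-- Kinetic composition `(t,x,v) ∘ (s,y,w) = (t+s, x+y+s v, v+w)`. -/
def kmul {d : ℕ} (a b : Pt d) : Pt d :=
  (a.1 + b.1, a.2.1 + b.2.1 + b.1 • a.2.2, a.2.2 + b.2.2)

/-- Kinetic inverse `(t,x,v)⁻¹ = (−t, −x+t v, −v)`. -/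
def kinv {d : ℕ} (a : Pt d) : Pt d :=
  (-a.1, -a.2.1 + a.1 • a.2.2, -a.2.2)

/-- `g₁(r) = r³ sin(log r)`, extended by `0` at `r = 0`. -/
def g1 (r : ℝ) : ℝ := r ^ 3 * Real.sin (Real.log r)

/-- `g₂(r) = r³ cos(log r)`, extended by `0` at `r = 0`. -/
def g2 (r : ℝ) : ℝ := r ^ 3 * Real.cos (Real.log r)

/-- `ġ₁(r)/(2r) = (r/2)(3 sin(log r) + cos(log r))`, extended by `0` at `r = 0`. -/
def h1 (r : ℝ) : ℝ := r / 2 * (3 * Real.sin (Real.log r) + Real.cos (Real.log r))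

/-- `ġ₂(r)/(2r) = (r/2)(3 cos(log r) − sin(log r))`, extended by `0` at `r = 0`. -/
def h2 (r : ℝ) : ℝ := r / 2 * (3 * Real.cos (Real.log r) - Real.sin (Real.log r))

/-- The matrix `W(r)`, recorded through its scalar block entries as a `2×2` real matrix;
the full `2d×2d` matrix is the blockwise tensor with `Id_d`. -/
def Wm (r : ℝ) : Matrix (Fin 2) (Fin 2) ℝ := !![g1 r, g2 r; h1 r, h2 r]

/-- The matrix `D_δ` (scalar block entries). -/
def Dm (δ : ℝ) : Matrix (Fin 2) (Fin 2) ℝ := !![δ, 0; 0, 1]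

/-- The matrix `E_δ(r)` (scalar block entries). -/
def Em (δ r : ℝ) : Matrix (Fin 2) (Fin 2) ℝ := !![1, δ * r ^ 2; 0, 1]

/-- `A_{m₀}(r) = D_{m₀} W(r) D_{m₀}⁻¹` (scalar block entries). -/
def Am (m0 r : ℝ) : Matrix (Fin 2) (Fin 2) ℝ := Dm m0 * Wm r * (Dm m0)⁻¹

/-- The action on `ℝ^d × ℝ^d` of a `2×2` block matrix whose blocks are the scalar
multiples of `Id_d` given by the entries of `M`. -/
def act {d : ℕ} (M : Matrix (Fin 2) (Fin 2) ℝ) (p : V d × V d) : V d × V d :=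
  (M 0 0 • p.1 + M 0 1 • p.2, M 1 0 • p.1 + M 1 1 • p.2)

/-- The kinetic trajectory `γ^m(r; (t,x,v))`. -/
def gammaK {d : ℕ} (m : Pt d) (z : Pt d) (r : ℝ) : Pt d :=
  (z.1 + m.1 * r ^ 2,
   (act (Em m.1 r) (z.2.1, z.2.2) + act (Am m.1 r) (m.2.1, m.2.2)).1,
   (act (Em m.1 r) (z.2.1, z.2.2) + act (Am m.1 r) (m.2.1, m.2.2)).2)

/-- Build a vector of `ℝ^d` from components. -/
def mkV {d : ℕ} (f : Fin d → ℝ) : V d := (EuclideanSpace.equiv (Fin d) ℝ).symm f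

/-- The argument `(s/r², A_{s/r²}(r)⁻¹ (y,w)ᵀ)` fed into `ψ`. -/
def psiArg {d : ℕ} (r : ℝ) (m : Pt d) : Pt d :=
  (m.1 / r ^ 2,
   (act ((Am (m.1 / r ^ 2) r)⁻¹) (m.2.1, m.2.2)).1,
   (act ((Am (m.1 / r ^ 2) r)⁻¹) (m.2.1, m.2.2)).2)

/-- The mollification kernel `K_r(s,y,w) = 2^d r^{−Q} ψ(s/r², A_{s/r²}(r)⁻¹(y,w)ᵀ)`,
with `Q = 4d+2`. -/
def Kker {d : ℕ} (ψ : Pt d → ℝ) (r : ℝ) (m : Pt d) : ℝ :=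
  2 ^ d * r ^ (-(4 * (d : ℤ) + 2)) * ψ (psiArg r m)

/-- The kernel `K̃_r(s,y,w) = −2^{d+1} s r^{−Q−1} ψ(s/r², A_{s/r²}(r)⁻¹(y,w)ᵀ)`. -/
def Ktil {d : ℕ} (ψ : Pt d → ℝ) (r : ℝ) (m : Pt d) : ℝ :=
  -(2 ^ (d + 1)) * m.1 * r ^ (-(4 * (d : ℤ) + 2) - 1) * ψ (psiArg r m)

/-- First coefficient of the forcing matrix `F_{m₀}(r)`: `(1/m₀) ∂_r (ġ₁(r)/(2r))`. -/
def F1 (m0 r : ℝ) : ℝ := (1 / m0) * deriv h1 r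

/-- Second coefficient of the forcing matrix `F_{m₀}(r)`: `∂_r (ġ₂(r)/(2r))`. -/
def F2 (r : ℝ) : ℝ := deriv h2 r

/-- The kernel `K⃗_r(s,y,w) = −2^d r^{−Q} ψ(⋯) F_{s/r²}(r) A_{s/r²}(r)⁻¹ (y,w)ᵀ ∈ ℝ^d`. -/
def Kvec {d : ℕ} (ψ : Pt d → ℝ) (r : ℝ) (m : Pt d) : V d :=
  (-(2 ^ d) * r ^ (-(4 * (d : ℤ) + 2)) * ψ (psiArg r m)) •
    (F1 (m.1 / r ^ 2) r • (act ((Am (m.1 / r ^ 2) r)⁻¹) (m.2.1, m.2.2)).1 +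
      F2 r • (act ((Am (m.1 / r ^ 2) r)⁻¹) (m.2.1, m.2.2)).2)

/-- The gradient of `u : ℝ^{1+2d} → ℝ` in the `x`-variables (the `m₁` block). -/
def gradX {d : ℕ} (u : Pt d → ℝ) (z : Pt d) : V d :=
  mkV fun i => fderiv ℝ u z (0, EuclideanSpace.single i 1, 0)

/-- The gradient of `u : ℝ^{1+2d} → ℝ` in the `v`-variables (the `m₂` block). -/
def gradV {d : ℕ} (u : Pt d → ℝ) (z : Pt d) : V d :=
  mkV fun i => fderiv ℝ u z (0, 0, EuclideanSpace.single i 1)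

/-- The kernel `K⃗^π_r(s,y,w)
  = 2^{d+1} s r^{−Q−1} [(A_{s/r²}(r)⁻¹)_{·;2}]ᵀ [∇_{(m₁,m₂)}ψ](⋯) ∈ ℝ^d`. -/
def Kpi {d : ℕ} (ψ : Pt d → ℝ) (r : ℝ) (m : Pt d) : V d :=
  (2 ^ (d + 1) * m.1 * r ^ (-(4 * (d : ℤ) + 2) - 1)) •
    ((Am (m.1 / r ^ 2) r)⁻¹ 0 1 • gradX ψ (psiArg r m) +
      (Am (m.1 / r ^ 2) r)⁻¹ 1 1 • gradV ψ (psiArg r m))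

/-- Kinetic convolution operator for scalar kernels:
`[T_J f](z) = ∫ J(z⁻¹ ∘ m) f(m) dm`. -/
def Tsc {d : ℕ} (J : Pt d → ℝ) (f : Pt d → ℝ) (z : Pt d) : ℝ :=
  ∫ m, J (kmul (kinv z) m) * f m

/-- Kinetic convolution operator for `ℝ^d`-valued kernels:
`[T_J f](z) = ∫ J(z⁻¹ ∘ m) · f(m) dm`. -/
def Tvec {d : ℕ} (J : Pt d → V d) (f : Pt d → V d) (z : Pt d) : ℝ :=
  ∫ m, ⟪J (kmul (kinv z) m), f m⟫

/-- The support and nonnegativity conditions on the bump function `ψ`: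
smooth, nonnegative, unit mass, supported in `(−2,−1) × B₁(0) × B₁(0)`. -/
structure IsKineticBump {d : ℕ} (ψ : Pt d → ℝ) : Prop where
  smooth : ContDiff ℝ (⊤ : ℕ∞) ψ
  nonneg : ∀ m, 0 ≤ ψ m
  mass : ∫ m, ψ m = 1
  supp : ∀ m : Pt d, ψ m ≠ 0 →
    m.1 ∈ Set.Ioo (-2 : ℝ) (-1) ∧ ‖m.2.1‖ < 1 ∧ ‖m.2.2‖ < 1

/-- The kinetic box `B_r^kin = {(s,y,w) : |s| < r², |y| < r³, |w| < r}`. -/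
def kinBox (d : ℕ) (r : ℝ) : Set (Pt d) :=
  {m | |m.1| < r ^ 2 ∧ ‖m.2.1‖ < r ^ 3 ∧ ‖m.2.2‖ < r}

/-- `A_{m₀}(r)` in terms of its scalar block entries. -/
lemma Am_eq {m0 : ℝ} (hm : m0 ≠ 0) (r : ℝ) :
    Am m0 r = !![g1 r, m0 * g2 r; h1 r * m0⁻¹, h2 r] := by
  have hD : (Dm m0)⁻¹ = !![m0⁻¹, 0; 0, 1] := by
    apply Matrix.inv_eq_right_inv
    ext i j
    fin_cases i <;> fin_cases j <;> simp [Dm, hm]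
  rw [Am, hD, Dm, Wm]
  ext i j
  fin_cases i <;> fin_cases j <;> simp
  field_simp

/-- The inverse of `A_{m₀}(r)` (scalar block entries). -/
def AmInv (m0 r : ℝ) : Matrix (Fin 2) (Fin 2) ℝ :=
  !![(Real.sin (Real.log r) - 3 * Real.cos (Real.log r)) * r ^ (-3 : ℤ),
      2 * Real.cos (Real.log r) * m0 * r⁻¹;
    (3 * Real.sin (Real.log r) + Real.cos (Real.log r)) * m0⁻¹ * r ^ (-3 : ℤ),
      -2 * Real.sin (Real.log r) * r⁻¹]

lemma Am_mul_AmInv {m0 r : ℝ} (hm : m0 ≠ 0) (hr : r ≠ 0) : Am m0 r * AmInv m0 r = 1 := by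
  have h := Real.sin_sq_add_cos_sq (Real.log r)
  have hz : r ^ (-3 : ℤ) = (r ^ 3)⁻¹ := by rw [zpow_neg]; norm_cast
  rw [Am_eq hm, AmInv, hz, g1, g2, h1, h2]
  generalize Real.sin (Real.log r) = s at *
  generalize Real.cos (Real.log r) = c at *
  ext i j
  fin_cases i <;> fin_cases j <;> simp <;> field_simp <;>
    first | ring1 | linear_combination h

lemma abs_mul_sin_add_mul_cos_le (a b x : ℝ) :
    |a * Real.sin x + b * Real.cos x| ≤ |a| + |b| := by
  refine (abs_add_le _ _).trans (add_le_add ?_ ?_) <;> rw [abs_mul]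
  · exact mul_le_of_le_one_right (abs_nonneg a) (Real.abs_sin_le_one x)
  · exact mul_le_of_le_one_right (abs_nonneg b) (Real.abs_cos_le_one x)

/-- **(M3): bounds on the blocks of the inverse matrix.**
There is `C > 0` such that for all `m₀ ≠ 0`, `r > 0`, the matrix `A_{m₀}(r)` is invertible
and, writing the `(i,j)`-block of `A_{m₀}(r)⁻¹` as `a_{ij} Id_d` (i.e. `a_{ij}` is the
`(i,j)` entry of the `2×2` scalar-block representation), one has
`|a_{i1}| ≤ C (1 + |m₀|⁻¹) r⁻³` and `|a_{i2}| ≤ C (1 + |m₀|) r⁻¹`. -/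
theorem statement2 (d : ℕ) (hd : 1 ≤ d) :
    ∃ C : ℝ, 0 < C ∧ ∀ m0 : ℝ, m0 ≠ 0 → ∀ r : ℝ, 0 < r →
      IsUnit (Am m0 r) ∧ ∀ i : Fin 2,
        |(Am m0 r)⁻¹ i 0| ≤ C * (1 + |m0|⁻¹) * r ^ (-3 : ℤ) ∧
        |(Am m0 r)⁻¹ i 1| ≤ C * (1 + |m0|) * r⁻¹ := by
  refine ⟨4, by norm_num, fun m0 hm r hr => ?_⟩
  have hmul := Am_mul_AmInv hm hr.ne'
  refine ⟨IsUnit.of_mul_eq_one _ hmul, ?_⟩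
  rw [Matrix.inv_eq_right_inv hmul]
  have bound : ∀ {a t p : ℝ}, |a| ≤ 4 → 0 ≤ p → |t| ≤ p → ∀ {q : ℝ}, 0 ≤ q →
      |a * t * q| ≤ 4 * p * q := by
    intro a t p ha hp ht q hq
    rw [abs_mul, abs_mul, abs_of_nonneg hq]
    gcongr
  have hz : 0 ≤ r ^ (-3 : ℤ) := by positivity
  have hi : 0 ≤ r⁻¹ := by positivity
  have trig (a b : ℝ) (hab : |a| + |b| ≤ 4) :
      |a * Real.sin (Real.log r) + b * Real.cos (Real.log r)| ≤ 4 :=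
    (abs_mul_sin_add_mul_cos_le a b _).trans hab
  intro i
  fin_cases i
  · constructor
    · have := bound (t := 1) (trig 1 (-3) (by norm_num)) (by positivity : 0 ≤ 1 + |m0|⁻¹)
        (by simp) hz
      convert this using 2
      simp [AmInv, sub_eq_add_neg]
    · have := bound (t := m0) (trig 0 2 (by norm_num)) (by positivity : 0 ≤ 1 + |m0|)
        (by simp) hi
      convert this using 2
      simp [AmInv]
  · constructor
    · have := bound (t := m0⁻¹) (trig 3 1 (by norm_num)) (by positivity : 0 ≤ 1 + |m0|⁻¹)
        (by simp [abs_inv]) hz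
      convert this using 2
      simp [AmInv]
    · have := bound (t := 1) (trig (-2) 0 (by norm_num)) (by positivity : 0 ≤ 1 + |m0|)
        (by simp) hi
      convert this using 2
      simp [AmInv]
end
end

section
/- (Representation formula for the mollification defect, equation (eq:repfTtauf).) Suppose f ∈ 𝒮(ℝ^{1+2d}) satisfies (∂_t + v·∇_x) f = ∇_v · S_0 + S_1 pointwise on ℝ^{1+2d} with S_0 ∈ 𝒮(ℝ^{1+2d}; ℝ^d) and S_1 ∈ 𝒮(ℝ^{1+2d}). Then for every τ > 0 and every z ∈ ℝ^{1+2d}, f(z) − [T_{K_τ} f](z) = ∫_0^τ ( [T_{K⃗^π_r} S_0](z) + [T_{K̃_r} S_1](z) + [T_{K⃗_r} (∇_v f)](z) ) dr, where all integrals converge absolutely. -/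
open MeasureTheory Real ENNReal
open scoped RealInnerProductSpace

noncomputable section

instance isAddHaarMeasure_volume_prod (d : ℕ) :
    (volume : Measure (V d × V d)).IsAddHaarMeasure :=
  Measure.prod.instIsAddHaarMeasure volume volume

instance isAddHaarMeasure_volume_pt (d : ℕ) : (volume : Measure (Pt d)).IsAddHaarMeasure :=
  Measure.prod.instIsAddHaarMeasure volume volume

/-- The block linear map `(x, y) ↦ (a x + b y, c x + e y)`. -/
def blockMap (d : ℕ) (a b c e : ℝ) : (V d × V d) →ₗ[ℝ] (V d × V d) :=
  LinearMap.prod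
    (a • LinearMap.fst ℝ (V d) (V d) + b • LinearMap.snd ℝ (V d) (V d))
    (c • LinearMap.fst ℝ (V d) (V d) + e • LinearMap.snd ℝ (V d) (V d))

lemma blockMap_apply {d : ℕ} (a b c e : ℝ) (p : V d × V d) :
    blockMap d a b c e p = (a • p.1 + b • p.2, c • p.1 + e • p.2) := rfl

lemma det_fromBlocks_smul_one {n : Type*} [Fintype n] [DecidableEq n] (a b c e : ℝ) :
    (Matrix.fromBlocks (a • (1 : Matrix n n ℝ)) (b • (1 : Matrix n n ℝ))
      (c • (1 : Matrix n n ℝ)) (e • (1 : Matrix n n ℝ))).det =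
      (a * e - b * c) ^ Fintype.card n := by
  have h := Matrix.det_kronecker !![a, b; c, e] (1 : Matrix n n ℝ)
  rw [Matrix.det_one, one_pow, mul_one, Matrix.det_fin_two_of] at h
  rw [← h, ← Matrix.det_reindex_self
    ((finTwoEquiv.prodCongr (Equiv.refl n)).trans (Equiv.boolProdEquivSum n))]
  congr 1
  ext i j
  rcases i with i | i <;> rcases j with j | j <;>
    simp [Matrix.kroneckerMap_apply, finTwoEquiv, Equiv.boolProdEquivSum]

lemma det_blockMap (d : ℕ) (a b c e : ℝ) :
    LinearMap.det (blockMap d a b c e) = (a * e - b * c) ^ d := by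
  let B := (EuclideanSpace.basisFun (Fin d) ℝ).toBasis
  rw [← LinearMap.det_toMatrix (B.prod B)]
  have : LinearMap.toMatrix (B.prod B) (B.prod B) (blockMap d a b c e) =
      Matrix.fromBlocks (a • (1 : Matrix (Fin d) (Fin d) ℝ)) (b • (1 : Matrix (Fin d) (Fin d) ℝ))
        (c • (1 : Matrix (Fin d) (Fin d) ℝ)) (e • (1 : Matrix (Fin d) (Fin d) ℝ)) := by
    ext i j
    rw [LinearMap.toMatrix_apply]
    rcases i with i | i <;> rcases j with j | j <;>
      simp [B, blockMap_apply, Matrix.one_apply]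
  rw [this, det_fromBlocks_smul_one, Fintype.card_fin]

lemma map_blockMap_volume (d : ℕ) {a b c e : ℝ} (h : a * e - b * c ≠ 0) :
    Measure.map (blockMap d a b c e) volume =
      ENNReal.ofReal ((|a * e - b * c| ^ d)⁻¹) • (volume : Measure (V d × V d)) := by
  have hdet : LinearMap.det (blockMap d a b c e) ≠ 0 := by
    rw [det_blockMap]; exact pow_ne_zero _ h
  rw [Measure.map_linearMap_addHaar_eq_smul_addHaar volume hdet, det_blockMap, abs_inv, abs_pow]

/-- The determinant of `W(r)`. -/
lemma det_Wm (r : ℝ) : g1 r * h2 r - g2 r * h1 r = -(r ^ 4 / 2) := by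
  unfold g1 g2 h1 h2
  linear_combination (-(r ^ 4) / 2) * Real.sin_sq_add_cos_sq (Real.log r)

/-- The dilation `(m₀, m₁, m₂) ↦ (m₀ r², A_{m₀}(r)(m₁, m₂))` in explicit coordinates. -/
def kdil {d : ℕ} (r : ℝ) (m : Pt d) : Pt d :=
  (m.1 * r ^ 2, blockMap d (g1 r) (m.1 * g2 r) (h1 r / m.1) (h2 r) m.2)

lemma measurable_g1 : Measurable g1 := by unfold g1; fun_prop
lemma measurable_g2 : Measurable g2 := by unfold g2; fun_prop
lemma measurable_h1 : Measurable h1 := by unfold h1; fun_prop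
lemma measurable_h2 : Measurable h2 := by unfold h2; fun_prop

lemma measurable_kdil {d : ℕ} : Measurable (fun p : ℝ × Pt d => kdil p.1 p.2) := by
  have := measurable_g1
  have := measurable_g2
  have := measurable_h1
  have := measurable_h2
  simp only [kdil, blockMap_apply]
  fun_prop

/-- The trajectory `r ↦ z ∘ (m₀ r², A_{m₀}(r)(m₁, m₂))`. -/
def ktraj {d : ℕ} (z : Pt d) (r : ℝ) (m : Pt d) : Pt d := kmul z (kdil r m)

lemma continuous_kmul {d : ℕ} (z : Pt d) : Continuous (kmul z) := by
  unfold kmul; fun_prop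

lemma kmul_kinv_kmul {d : ℕ} (z m : Pt d) : kmul (kinv z) (kmul z m) = m := by
  refine Prod.ext ?_ (Prod.ext ?_ ?_)
  · simp [kmul, kinv]
  · simp only [kmul, kinv]; module
  · simp [kmul, kinv]

lemma measurable_ktraj {d : ℕ} (z : Pt d) :
    Measurable (fun p : ℝ × Pt d => ktraj z p.1 p.2) :=
  (continuous_kmul z).measurable.comp measurable_kdil

lemma measurePreserving_kmul {d : ℕ} (z : Pt d) : MeasurePreserving (kmul z) volume volume := by
  have h := (measurePreserving_add_left (volume : Measure ℝ) z.1).skew_product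
    (g := fun (s : ℝ) (p : V d × V d) => ((z.2.1 + s • z.2.2, z.2.2) : V d × V d) + p)
    (μc := volume) (μd := volume) (by unfold Function.uncurry; fun_prop)
    (Filter.Eventually.of_forall fun s => (measurePreserving_add_left volume _).map_eq)
  have he : kmul z = fun m : Pt d => (z.1 + m.1, (z.2.1 + m.1 • z.2.2, z.2.2) + m.2) := by
    funext m
    refine Prod.ext rfl (Prod.ext ?_ rfl)
    simp only [kmul, Prod.fst_add]
    module
  rw [he]
  exact h

/-- The reciprocal Jacobian of the dilation. -/
def kjac (d : ℕ) (r : ℝ) : ℝ := 2 ^ d * r ^ (-(4 * (d : ℤ) + 2))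

lemma kjac_eq {d : ℕ} {r : ℝ} (hr : 0 < r) :
    kjac d r = |(r ^ 2)⁻¹| * (|-(r ^ 4 / 2)| ^ d)⁻¹ := by
  rw [abs_neg, abs_of_pos (by positivity), abs_of_pos (by positivity), kjac, zpow_neg,
    zpow_add₀ hr.ne', zpow_mul]
  norm_cast
  rw [div_pow]
  push_cast
  field_simp

lemma kjac_pos {d : ℕ} {r : ℝ} (hr : 0 < r) : 0 < kjac d r := by
  unfold kjac; positivity

lemma ae_fst_ne_zero (d : ℕ) : ∀ᵐ m : Pt d, m.1 ≠ 0 :=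
  (Measure.quasiMeasurePreserving_fst (μ := volume) (ν := (volume : Measure (V d × V d)))).ae
    (Measure.ae_ne volume (0 : ℝ))

lemma map_kdil {d : ℕ} {r : ℝ} (hr : 0 < r) :
    Measure.map (kdil r) (volume : Measure (Pt d)) = ENNReal.ofReal (kjac d r) • volume := by
  have h0 : MeasurePreserving (fun s : ℝ => s * r ^ 2) volume
      (ENNReal.ofReal |(r ^ 2)⁻¹| • volume) :=
    ⟨by fun_prop, Real.map_volume_mul_right (by positivity)⟩
  have h := h0.skew_product
    (g := fun (s : ℝ) (p : V d × V d) => blockMap d (g1 r) (s * g2 r) (h1 r / s) (h2 r) p)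
    (μc := volume) (μd := ENNReal.ofReal ((|-(r ^ 4 / 2)| ^ d)⁻¹) • volume)
    (by unfold Function.uncurry; simp only [blockMap_apply]; fun_prop)
    (by
      filter_upwards [Measure.ae_ne volume (0 : ℝ)] with s hs
      have hdet : g1 r * h2 r - s * g2 r * (h1 r / s) = -(r ^ 4 / 2) := by
        rw [← det_Wm]; field_simp
      have hne : g1 r * h2 r - s * g2 r * (h1 r / s) ≠ 0 := by
        rw [hdet]; exact neg_ne_zero.mpr (by positivity)
      rw [map_blockMap_volume d hne, hdet])
  have h' := h.map_eq
  rw [Measure.prod_smul_left, Measure.prod_smul_right, smul_smul,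
    ← ENNReal.ofReal_mul (abs_nonneg _), ← kjac_eq hr] at h'
  exact h'

lemma map_ktraj {d : ℕ} (z : Pt d) {r : ℝ} (hr : 0 < r) :
    Measure.map (ktraj z r) (volume : Measure (Pt d)) = ENNReal.ofReal (kjac d r) • volume := by
  have hm : Measurable (kdil (d := d) r) := measurable_kdil.comp measurable_prodMk_left
  change Measure.map (kmul z ∘ kdil r) volume = _
  rw [← Measure.map_map (continuous_kmul z).measurable hm, map_kdil hr, Measure.map_smul,
    (measurePreserving_kmul z).map_eq]

lemma Am_apply {m0 : ℝ} (hm : m0 ≠ 0) (r : ℝ) :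
    Am m0 r = !![g1 r, m0 * g2 r; h1 r / m0, h2 r] := by
  have : (Dm m0)⁻¹ = !![m0⁻¹, 0; 0, 1] := by
    rw [Dm, Matrix.inv_def, Matrix.det_fin_two_of, Matrix.adjugate_fin_two_of]
    ext i j; fin_cases i <;> fin_cases j <;> simp [hm]
  rw [Am, this, Dm, Wm]
  ext i j
  fin_cases i <;> fin_cases j <;> simp [Matrix.mul_apply, Fin.sum_univ_two] <;> field_simp

lemma Am_inv_apply {m0 r : ℝ} (hm : m0 ≠ 0) (hr : r ≠ 0) :
    (Am m0 r)⁻¹ = !![-(2 * h2 r / r ^ 4), 2 * m0 * g2 r / r ^ 4;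
      2 * h1 r / (m0 * r ^ 4), -(2 * g1 r / r ^ 4)] := by
  have hdet : g1 r * h2 r - m0 * g2 r * (h1 r / m0) = -(r ^ 4 / 2) := by
    rw [← det_Wm]; field_simp
  rw [Am_apply hm, Matrix.inv_def, Matrix.det_fin_two_of, Matrix.adjugate_fin_two_of, hdet,
    Ring.inverse_eq_inv']
  ext i j
  fin_cases i <;> fin_cases j <;> simp <;> field_simp

lemma act_inv_act {d : ℕ} {M : Matrix (Fin 2) (Fin 2) ℝ} (hM : IsUnit M.det) (p : V d × V d) :
    act M⁻¹ (act M p) = p := by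
  have h := Matrix.nonsing_inv_mul M hM
  have e : ∀ i j, M⁻¹ i 0 * M 0 j + M⁻¹ i 1 * M 1 j = (1 : Matrix (Fin 2) (Fin 2) ℝ) i j := by
    intro i j
    rw [← h, Matrix.mul_apply, Fin.sum_univ_two]
  have e00 := e 0 0
  have e01 := e 0 1
  have e10 := e 1 0
  have e11 := e 1 1
  simp at e00 e01 e10 e11
  refine Prod.ext ?_ ?_
  · simp only [act, smul_add, smul_smul]
    calc _ = (M⁻¹ 0 0 * M 0 0 + M⁻¹ 0 1 * M 1 0) • p.1 +
          (M⁻¹ 0 0 * M 0 1 + M⁻¹ 0 1 * M 1 1) • p.2 := by module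
      _ = p.1 := by rw [e00, e01]; simp
  · simp only [act, smul_add, smul_smul]
    calc _ = (M⁻¹ 1 0 * M 0 0 + M⁻¹ 1 1 * M 1 0) • p.1 +
          (M⁻¹ 1 0 * M 0 1 + M⁻¹ 1 1 * M 1 1) • p.2 := by module
      _ = p.2 := by rw [e10, e11]; simp

lemma psiArg_kdil {d : ℕ} {r : ℝ} (hr : r ≠ 0) {m : Pt d} (hm : m.1 ≠ 0) :
    psiArg r (kdil r m) = m := by
  have hs : m.1 * r ^ 2 / r ^ 2 = m.1 := by field_simp
  have hk : (kdil r m).2 = act (Am m.1 r) m.2 := by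
    simp [kdil, blockMap_apply, act, Am_apply hm]
  have hu : IsUnit (Am m.1 r).det := by
    have hdet : g1 r * h2 r - m.1 * g2 r * (h1 r / m.1) = -(r ^ 4 / 2) := by
      rw [← det_Wm]; field_simp
    rw [Am_apply hm, Matrix.det_fin_two_of, hdet, isUnit_iff_ne_zero]
    exact neg_ne_zero.mpr (by positivity)
  have hf : (kdil r m).1 / r ^ 2 = m.1 := hs
  unfold psiArg
  rw [hf, Prod.mk.eta, Prod.mk.eta, hk, act_inv_act hu]

lemma measurable_matrix_inv_apply {M : ℝ → Matrix (Fin 2) (Fin 2) ℝ}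
    (hM : ∀ i j, Measurable fun s => M s i j) (i j : Fin 2) :
    Measurable fun s => (M s)⁻¹ i j := by
  have hdet : Measurable fun s => ((M s).det)⁻¹ := by
    simp only [Matrix.det_fin_two]
    exact (((hM 0 0).mul (hM 1 1)).sub ((hM 0 1).mul (hM 1 0))).inv
  have hadj : Measurable fun s => (M s).adjugate i j := by
    simp only [Matrix.adjugate_fin_two]
    fin_cases i <;> fin_cases j
    · exact hM 1 1
    · exact (hM 0 1).neg
    · exact (hM 1 0).neg
    · exact hM 0 0
  simp only [Matrix.inv_def, Ring.inverse_eq_inv', Matrix.smul_apply, smul_eq_mul]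
  exact hdet.mul hadj

lemma measurable_Am_inv_apply (r : ℝ) (i j : Fin 2) : Measurable fun s : ℝ => (Am s r)⁻¹ i j := by
  have hD : ∀ i j, Measurable fun s : ℝ => (Dm s) i j := by
    intro i j
    fin_cases i <;> fin_cases j
    · exact measurable_id
    · exact measurable_const
    · exact measurable_const
    · exact measurable_const
  have hDI := fun i j => measurable_matrix_inv_apply hD i j
  refine measurable_matrix_inv_apply (fun i j => ?_) i j
  simp only [Am, Matrix.mul_apply, Fin.sum_univ_two]
  exact ((((hD i 0).mul_const _).add ((hD i 1).mul_const _)).mul (hDI 0 j)).add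
    ((((hD i 0).mul_const _).add ((hD i 1).mul_const _)).mul (hDI 1 j))

lemma measurable_psiArg {d : ℕ} (r : ℝ) : Measurable (psiArg (d := d) r) := by
  have hq : Measurable fun m : Pt d => m.1 / r ^ 2 := measurable_fst.div_const _
  have h := fun i j => (measurable_Am_inv_apply r i j).comp hq
  have h1 : Measurable fun m : Pt d => m.2.1 := measurable_snd.fst
  have h2 : Measurable fun m : Pt d => m.2.2 := measurable_snd.snd
  exact hq.prodMk ((((h 0 0).smul h1).add ((h 0 1).smul h2)).prodMk
    (((h 1 0).smul h1).add ((h 1 1).smul h2)))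

/-- Change of variables along the trajectories. -/
lemma integral_comp_psiArg {d : ℕ} (z : Pt d) {r : ℝ} (hr : 0 < r) (Φ : Pt d → Pt d → ℝ)
    (hΦ : Measurable (Function.uncurry Φ))
    (hint : Integrable fun m => Φ m (ktraj z r m)) :
    (Integrable fun n => kjac d r * Φ (psiArg r (kmul (kinv z) n)) n) ∧
    ∫ n, kjac d r * Φ (psiArg r (kmul (kinv z) n)) n = ∫ m, Φ m (ktraj z r m) := by
  set F : Pt d → ℝ := fun n => Φ (psiArg r (kmul (kinv z) n)) n with hF
  have hFm : Measurable F := hΦ.comp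
    (((measurable_psiArg r).comp (continuous_kmul _).measurable).prodMk measurable_id)
  have hγ : Measurable (ktraj z r) := (measurable_ktraj z).comp measurable_prodMk_left
  have hae : (fun m => F (ktraj z r m)) =ᵐ[volume] fun m => Φ m (ktraj z r m) := by
    filter_upwards [ae_fst_ne_zero d] with m hm
    simp only [hF]
    conv_lhs => rw [ktraj, kmul_kinv_kmul, psiArg_kdil hr.ne' hm]
    rfl
  have hJ := (kjac_pos (d := d) hr)
  have h1 : Integrable F (Measure.map (ktraj z r) volume) := by
    rw [integrable_map_measure hFm.aestronglyMeasurable hγ.aemeasurable]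
    exact hint.congr hae.symm
  have h2 := integral_map (μ := volume) hγ.aemeasurable hFm.aestronglyMeasurable
  rw [map_ktraj z hr] at h1 h2
  rw [integral_smul_measure, ENNReal.toReal_ofReal hJ.le, integral_congr_ae hae] at h2
  refine ⟨Integrable.const_mul ?_ _, ?_⟩
  · rwa [integrable_smul_measure (by simpa using hJ) ENNReal.ofReal_ne_top] at h1
  · rw [integral_const_mul]; exact h2

/-- The closed box `[-2, -1] × B̄₁(0) × B̄₁(0)` containing the support of a kinetic bump. -/
def bumpBox (d : ℕ) : Set (Pt d) :=
  Set.Icc (-2 : ℝ) (-1) ×ˢ (Metric.closedBall (0 : V d) 1 ×ˢ Metric.closedBall (0 : V d) 1)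

lemma isCompact_bumpBox (d : ℕ) : IsCompact (bumpBox d) :=
  isCompact_Icc.prod ((isCompact_closedBall _ _).prod (isCompact_closedBall _ _))

lemma mem_bumpBox {d : ℕ} {m : Pt d} (hm : m ∈ bumpBox d) :
    m.1 ≠ 0 ∧ |m.1| ≤ 2 ∧ |m.1⁻¹| ≤ 1 ∧ ‖m.2.1‖ ≤ 1 ∧ ‖m.2.2‖ ≤ 1 := by
  obtain ⟨⟨h1, h2⟩, h3, h4⟩ := hm
  have habs : 1 ≤ |m.1| := by rw [abs_of_neg (by linarith)]; linarith
  refine ⟨by linarith, abs_le.mpr ⟨h1, by linarith⟩, ?_, by simpa using h3, by simpa using h4⟩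
  rw [abs_inv]
  exact inv_le_one_of_one_le₀ habs

lemma integrable_of_bumpBox {d : ℕ} {G : Pt d → ℝ} (hG : Measurable G)
    (h0 : ∀ m ∉ bumpBox d, G m = 0) {C : ℝ} (hC : ∀ m ∈ bumpBox d, |G m| ≤ C) :
    Integrable G := by
  have hK := isCompact_bumpBox d
  have hi : IntegrableOn G (bumpBox d) :=
    IntegrableOn.of_bound hK.measure_lt_top hG.aestronglyMeasurable C
      ((ae_restrict_iff' hK.measurableSet).mpr (Filter.Eventually.of_forall hC))
  exact (integrableOn_iff_integrable_of_support_subset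
    (fun m hm => by_contra fun h => hm (h0 m h))).mp hi

namespace IsKineticBump

variable {d : ℕ} {ψ : Pt d → ℝ}

lemma tsupport_subset (hψ : IsKineticBump ψ) : tsupport ψ ⊆ bumpBox d := by
  refine closure_minimal (fun m hm => ?_) (isCompact_bumpBox d).isClosed
  obtain ⟨h1, h2, h3⟩ := hψ.supp m hm
  exact ⟨⟨h1.1.le, h1.2.le⟩, by simpa using h2.le, by simpa using h3.le⟩

lemma hasCompactSupport (hψ : IsKineticBump ψ) : HasCompactSupport ψ :=
  (isCompact_bumpBox d).of_isClosed_subset (isClosed_tsupport _) hψ.tsupport_subset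

lemma eq_zero (hψ : IsKineticBump ψ) {m : Pt d} (hm : m ∉ bumpBox d) : ψ m = 0 :=
  image_eq_zero_of_notMem_tsupport fun h => hm (hψ.tsupport_subset h)

lemma fderiv_eq_zero (hψ : IsKineticBump ψ) {m : Pt d} (hm : m ∉ bumpBox d) :
    fderiv ℝ ψ m = 0 := by
  by_contra h
  exact hm (hψ.tsupport_subset (support_fderiv_subset ℝ h))

lemma exists_bound (hψ : IsKineticBump ψ) : ∃ C, 0 ≤ C ∧ ∀ m, |ψ m| ≤ C := by
  obtain ⟨C, hC⟩ := hψ.hasCompactSupport.exists_bound_of_continuous hψ.smooth.continuous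
  exact ⟨C, (norm_nonneg _).trans (hC 0), hC⟩

lemma continuous_fderiv (hψ : IsKineticBump ψ) : Continuous (fderiv ℝ ψ) :=
  hψ.smooth.continuous_fderiv (by simp)

lemma exists_fderiv_bound (hψ : IsKineticBump ψ) : ∃ C, 0 ≤ C ∧ ∀ m, ‖fderiv ℝ ψ m‖ ≤ C := by
  obtain ⟨C, hC⟩ := (hψ.hasCompactSupport.fderiv (𝕜 := ℝ)).exists_bound_of_continuous
    hψ.continuous_fderiv
  exact ⟨C, (norm_nonneg _).trans (hC 0), hC⟩

lemma integrable_mul (hψ : IsKineticBump ψ) {G : Pt d → ℝ} (hG : Measurable G) {C : ℝ}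
    (hC : ∀ m ∈ bumpBox d, |G m| ≤ C) : Integrable fun m => ψ m * G m := by
  obtain ⟨A, hA0, hA⟩ := hψ.exists_bound
  refine integrable_of_bumpBox (hψ.smooth.continuous.measurable.mul hG)
    (fun m hm => by rw [hψ.eq_zero hm, zero_mul]) (C := A * C) (fun m hm => ?_)
  rw [abs_mul]
  exact mul_le_mul (hA m) (hC m hm) (abs_nonneg _) hA0

end IsKineticBump

lemma gradV_apply {d : ℕ} (u : Pt d → ℝ) (z : Pt d) (i : Fin d) :
    gradV u z i = fderiv ℝ u z (0, 0, EuclideanSpace.single i 1) := rfl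

lemma gradX_apply {d : ℕ} (u : Pt d → ℝ) (z : Pt d) (i : Fin d) :
    gradX u z i = fderiv ℝ u z (0, EuclideanSpace.single i 1, 0) := rfl

lemma sum_single_smul {d : ℕ} (w : V d) :
    ∑ i, w i • (EuclideanSpace.single i (1 : ℝ) : V d) = w := by
  simpa using (EuclideanSpace.basisFun (Fin d) ℝ).sum_repr w

lemma inner_gradV {d : ℕ} (u : Pt d → ℝ) (z : Pt d) (w : V d) :
    ⟪w, gradV u z⟫ = fderiv ℝ u z (0, 0, w) := by
  let L : V d →L[ℝ] ℝ := (fderiv ℝ u z).comp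
    ((ContinuousLinearMap.inr ℝ ℝ (V d × V d)).comp (ContinuousLinearMap.inr ℝ (V d) (V d)))
  have hL : ∀ w, fderiv ℝ u z (0, 0, w) = L w := fun _ => rfl
  rw [hL, ← sum_single_smul w, map_sum, sum_single_smul, PiLp.inner_apply]
  refine Finset.sum_congr rfl fun i _ => ?_
  rw [map_smul, gradV_apply, hL, smul_eq_mul]
  simp [mul_comm]

lemma continuous_mkV {d : ℕ} {X : Type*} [TopologicalSpace X] {F : X → Fin d → ℝ}
    (hF : Continuous F) : Continuous fun x => mkV (F x) :=
  (EuclideanSpace.equiv (Fin d) ℝ).symm.continuous.comp hF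

lemma continuous_gradV {d : ℕ} {u : Pt d → ℝ} (hu : Continuous (fderiv ℝ u)) :
    Continuous (gradV u) :=
  continuous_mkV (continuous_pi fun _ => hu.clm_apply continuous_const)

namespace SchwartzMap

variable {E F : Type*} [NormedAddCommGroup E] [NormedSpace ℝ E] [NormedAddCommGroup F]
  [NormedSpace ℝ F]

lemma exists_norm_le (f : SchwartzMap E F) : ∃ C, 0 ≤ C ∧ ∀ x, ‖f x‖ ≤ C := by
  obtain ⟨C, hC0, hC⟩ := f.decay 0 0
  exact ⟨C, hC0.le, fun x => by simpa using hC x⟩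

lemma exists_norm_fderiv_le (f : SchwartzMap E F) : ∃ C, 0 ≤ C ∧ ∀ x, ‖fderiv ℝ f x‖ ≤ C := by
  obtain ⟨C, hC0, hC⟩ := f.decay 0 1
  refine ⟨C, hC0.le, fun x => ?_⟩
  simpa [norm_iteratedFDeriv_one] using hC x

lemma continuous_fderiv (f : SchwartzMap E F) : Continuous (fderiv ℝ f) :=
  (f.smooth 1).continuous_fderiv (by simp)

end SchwartzMap

lemma norm_snd_snd {d : ℕ} (w : V d) : ‖((0, 0, w) : Pt d)‖ = ‖w‖ := by
  simp [Prod.norm_def]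

lemma kjac_mul_pow {d : ℕ} {r : ℝ} (hr : 0 < r) (s : ℝ) :
    2 ^ (d + 1) * s * r ^ (-(4 * (d : ℤ) + 2) - 1) = kjac d r * (2 * (s / r ^ 2) * r) := by
  rw [kjac, zpow_sub₀ hr.ne', zpow_one, pow_succ]
  field_simp

lemma Ktil_eq {d : ℕ} (ψ : Pt d → ℝ) {r : ℝ} (hr : 0 < r) (m : Pt d) :
    Ktil ψ r m = kjac d r * (ψ (psiArg r m) * -(2 * (psiArg r m).1 * r)) := by
  have h := kjac_mul_pow (d := d) hr m.1
  have hp : (psiArg r m).1 = m.1 / r ^ 2 := rfl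
  rw [Ktil, hp]
  linear_combination (-ψ (psiArg r m)) * h

lemma integral_Kker {d : ℕ} {ψ : Pt d → ℝ} (hψ : IsKineticBump ψ) {G : Pt d → ℝ}
    (hG : Measurable G) {C : ℝ} (hC : ∀ n, |G n| ≤ C) (z : Pt d) {r : ℝ} (hr : 0 < r) :
    (Integrable fun n => Kker ψ r (kmul (kinv z) n) * G n) ∧
    Tsc (Kker ψ r) G z = ∫ m, ψ m * G (ktraj z r m) := by
  have hγ : Measurable (ktraj z r) := (measurable_ktraj z).comp measurable_prodMk_left
  have h := integral_comp_psiArg z hr (fun p n => ψ p * G n)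
    ((hψ.smooth.continuous.measurable.comp measurable_fst).mul (hG.comp measurable_snd))
    (hψ.integrable_mul (hG.comp hγ) fun m _ => hC _)
  have he : ∀ n, Kker ψ r (kmul (kinv z) n) * G n =
      kjac d r * (ψ (psiArg r (kmul (kinv z) n)) * G n) := fun n => by
    rw [Kker, kjac]; ring
  simpa only [Tsc, he] using h

lemma integral_Ktil {d : ℕ} {ψ : Pt d → ℝ} (hψ : IsKineticBump ψ) {G : Pt d → ℝ}
    (hG : Measurable G) {C : ℝ} (hC : ∀ n, |G n| ≤ C) (z : Pt d) {r : ℝ} (hr : 0 < r) :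
    (Integrable fun n => Ktil ψ r (kmul (kinv z) n) * G n) ∧
    Tsc (Ktil ψ r) G z = ∫ m, ψ m * (-(2 * m.1 * r) * G (ktraj z r m)) := by
  have hγ : Measurable (ktraj z r) := (measurable_ktraj z).comp measurable_prodMk_left
  have hψm := hψ.smooth.continuous.measurable
  have h := integral_comp_psiArg z hr (fun p n => ψ p * (-(2 * p.1 * r) * G n))
    (by unfold Function.uncurry; fun_prop)
    (hψ.integrable_mul (C := 2 * 2 * r * C) (by fun_prop) fun m hm => by
      obtain ⟨-, h2, -⟩ := mem_bumpBox hm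
      rw [abs_mul, abs_neg, abs_mul, abs_mul, abs_two, abs_of_pos hr]
      gcongr
      exact hC _)
  have he : ∀ n, Ktil ψ r (kmul (kinv z) n) * G n =
      kjac d r * (ψ (psiArg r (kmul (kinv z) n)) *
        (-(2 * (psiArg r (kmul (kinv z) n)).1 * r) * G n)) := fun n => by
    rw [Ktil_eq ψ hr]; ring
  simpa only [Tsc, he] using h

lemma integral_Kvec {d : ℕ} {ψ : Pt d → ℝ} (hψ : IsKineticBump ψ) (f : SchwartzMap (Pt d) ℝ)
    (z : Pt d) {r : ℝ} (hr : 0 < r) :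
    (Integrable fun n => ⟪Kvec ψ r (kmul (kinv z) n), gradV f n⟫) ∧
    Tvec (Kvec ψ r) (gradV f) z = ∫ m, ψ m *
      -⟪F1 m.1 r • m.2.1 + F2 r • m.2.2, gradV f (ktraj z r m)⟫ := by
  have hγ : Measurable (ktraj z r) := (measurable_ktraj z).comp measurable_prodMk_left
  have hψm := hψ.smooth.continuous.measurable
  have hgm := (continuous_gradV f.continuous_fderiv).measurable
  have hF : Measurable fun s => F1 s r := by unfold F1; fun_prop
  obtain ⟨A, hA0, hA⟩ := f.exists_norm_fderiv_le
  have h := integral_comp_psiArg z hr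
    (fun p n => ψ p * -⟪F1 p.1 r • p.2.1 + F2 r • p.2.2, gradV f n⟫)
    (by unfold Function.uncurry; fun_prop)
    (hψ.integrable_mul (C := A * (|deriv h1 r| + |F2 r|)) (by fun_prop) fun m hm => by
      obtain ⟨-, -, h2, h3, h4⟩ := mem_bumpBox hm
      rw [abs_neg, inner_gradV]
      refine ((fderiv ℝ f _).le_opNorm _).trans ?_
      rw [norm_snd_snd]
      refine mul_le_mul (hA _) ((norm_add_le _ _).trans ?_) (norm_nonneg _) hA0
      rw [norm_smul, norm_smul, F1, Real.norm_eq_abs, abs_mul, one_div, Real.norm_eq_abs]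
      have e1 : |m.1⁻¹| * |deriv h1 r| * ‖m.2.1‖ ≤ 1 * |deriv h1 r| * 1 := by gcongr
      have e2 : |F2 r| * ‖m.2.2‖ ≤ |F2 r| * 1 := by gcongr
      linarith)
  have he : ∀ n, ⟪Kvec ψ r (kmul (kinv z) n), gradV f n⟫ =
      kjac d r * (ψ (psiArg r (kmul (kinv z) n)) *
        -⟪F1 (psiArg r (kmul (kinv z) n)).1 r • (psiArg r (kmul (kinv z) n)).2.1 +
          F2 r • (psiArg r (kmul (kinv z) n)).2.2, gradV f n⟫) := fun n => by
    rw [Kvec, real_inner_smul_left, kjac]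
    simp only [psiArg]
    ring
  simpa only [Tvec, he] using h

lemma hasLineDerivAt_Ktil {d : ℕ} {ψ : Pt d → ℝ} (hψ : IsKineticBump ψ) (z : Pt d) (r : ℝ)
    (i : Fin d) (n : Pt d) :
    HasLineDerivAt ℝ (fun n => Ktil ψ r (kmul (kinv z) n)) (-(Kpi ψ r (kmul (kinv z) n) i)) n
      (0, 0, EuclideanSpace.single i 1) := by
  set k := kmul (kinv z) n with hk
  set e : V d := EuclideanSpace.single i 1 with he
  set B := (Am (k.1 / r ^ 2) r)⁻¹ with hB
  have hline : ∀ t : ℝ, kmul (kinv z) (n + t • ((0, 0, e) : Pt d)) = (k.1, k.2.1, k.2.2 + t • e) := by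
    intro t
    simp [hk, kmul, add_assoc]
  have harg : ∀ t : ℝ, psiArg r ((k.1, k.2.1, k.2.2 + t • e) : Pt d) =
      psiArg r k + t • ((0, B 0 1 • e, B 1 1 • e) : Pt d) := by
    intro t
    refine Prod.ext ?_ (Prod.ext ?_ ?_)
    · simp [psiArg]
    · simp only [psiArg, act, ← hB, Prod.snd_add, Prod.fst_add, Prod.smul_snd, Prod.smul_fst]
      module
    · simp only [psiArg, act, ← hB, Prod.snd_add, Prod.smul_snd]
      module
  have hd : HasLineDerivAt ℝ ψ (fderiv ℝ ψ (psiArg r k) (0, B 0 1 • e, B 1 1 • e)) (psiArg r k)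
      (0, B 0 1 • e, B 1 1 • e) :=
    ((hψ.smooth.differentiable (by simp)) _).hasFDerivAt.hasLineDerivAt _
  have hv : fderiv ℝ ψ (psiArg r k) (0, B 0 1 • e, B 1 1 • e) =
      B 0 1 * gradX ψ (psiArg r k) i + B 1 1 * gradV ψ (psiArg r k) i := by
    rw [gradX_apply, gradV_apply, ← smul_eq_mul, ← smul_eq_mul, ← map_smul, ← map_smul, ← map_add]
    simp [he]
  unfold HasLineDerivAt at hd ⊢
  simp only [hline, Ktil, harg]
  refine (hd.const_mul (-(2 ^ (d + 1)) * k.1 * r ^ (-(4 * (d : ℤ) + 2) - 1))).congr_deriv ?_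
  rw [hv]
  simp only [Kpi, PiLp.smul_apply, PiLp.add_apply, smul_eq_mul, ← hB]
  ring

lemma integrable_Kpi_apply {d : ℕ} {ψ : Pt d → ℝ} (hψ : IsKineticBump ψ) {G : Pt d → ℝ}
    (hG : Measurable G) {C : ℝ} (hC : ∀ n, |G n| ≤ C) (z : Pt d) {r : ℝ} (hr : 0 < r)
    (i : Fin d) :
    Integrable fun n => Kpi ψ r (kmul (kinv z) n) i * G n := by
  have hγ : Measurable (ktraj z r) := (measurable_ktraj z).comp measurable_prodMk_left
  have hX : Measurable fun p => gradX ψ p i :=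
    (hψ.continuous_fderiv.clm_apply continuous_const).measurable
  have hV : Measurable fun p => gradV ψ p i :=
    (hψ.continuous_fderiv.clm_apply continuous_const).measurable
  have hB0 := measurable_Am_inv_apply r 0 1
  have hB1 := measurable_Am_inv_apply r 1 1
  obtain ⟨A, hA0, hA⟩ := hψ.exists_fderiv_bound
  have hXb : ∀ p, |gradX ψ p i| ≤ A := fun p => by
    rw [gradX_apply, ← Real.norm_eq_abs]
    refine ((fderiv ℝ ψ p).le_opNorm _).trans ?_
    simpa [Prod.norm_def] using hA p
  have hVb : ∀ p, |gradV ψ p i| ≤ A := fun p => by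
    rw [gradV_apply, ← Real.norm_eq_abs]
    refine ((fderiv ℝ ψ p).le_opNorm _).trans ?_
    simpa [Prod.norm_def] using hA p
  have hC0 : 0 ≤ C := (abs_nonneg _).trans (hC 0)
  let P : Pt d → ℝ := fun p => 2 * p.1 * r *
    ((Am p.1 r)⁻¹ 0 1 * gradX ψ p i + (Am p.1 r)⁻¹ 1 1 * gradV ψ p i)
  have hP : Measurable P :=
    ((measurable_fst.const_mul 2).mul_const r).mul
      (((hB0.comp measurable_fst).mul hX).add ((hB1.comp measurable_fst).mul hV))
  have h := (integral_comp_psiArg z hr (fun p n => P p * G n)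
    ((hP.comp measurable_fst).mul (hG.comp measurable_snd))
    (integrable_of_bumpBox (hP.mul (hG.comp hγ))
      (C := (2 * 2 * r * (2 * 2 * |g2 r| / r ^ 4 * A + 2 * |g1 r| / r ^ 4 * A)) * C)
      (fun m hm => by simp [P, gradX_apply, gradV_apply, hψ.fderiv_eq_zero hm])
      fun m hm => by
        obtain ⟨h1, h2, -⟩ := mem_bumpBox hm
        have e1 : |(Am m.1 r)⁻¹ 0 1| ≤ 2 * 2 * |g2 r| / r ^ 4 := by
          rw [Am_inv_apply h1 hr.ne']
          simp only [Matrix.of_apply, Matrix.cons_val', Matrix.cons_val_zero, Matrix.cons_val_one,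
            Matrix.cons_val_fin_one]
          rw [abs_div, abs_mul, abs_mul, abs_two, abs_of_pos (pow_pos hr 4)]
          gcongr
        have e2 : |(Am m.1 r)⁻¹ 1 1| ≤ 2 * |g1 r| / r ^ 4 := by
          rw [Am_inv_apply h1 hr.ne']
          simp only [Matrix.of_apply, Matrix.cons_val', Matrix.cons_val_one, Matrix.cons_val_fin_one]
          rw [abs_neg, abs_div, abs_mul, abs_two, abs_of_pos (pow_pos hr 4)]
        simp only [P]
        rw [abs_mul, abs_mul, abs_mul, abs_mul, abs_two, abs_of_pos hr]
        gcongr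
        · refine (abs_add_le _ _).trans ?_
          rw [abs_mul, abs_mul]
          gcongr
          · exact hXb m
          · exact hVb m
        · exact hC _)).1
  have he : ∀ n, Kpi ψ r (kmul (kinv z) n) i * G n =
      kjac d r * (P (psiArg r (kmul (kinv z) n)) * G n) := fun n => by
    rw [Kpi, kjac_mul_pow hr]
    simp only [P, psiArg, PiLp.smul_apply, PiLp.add_apply, smul_eq_mul]
    ring
  simpa only [he] using h

/-- Integration by parts in the velocity variable, moving the velocity divergence from the
density onto the kernel. -/
lemma integral_Kpi {d : ℕ} {ψ : Pt d → ℝ} (hψ : IsKineticBump ψ) (S : SchwartzMap (Pt d) (V d))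
    (z : Pt d) {r : ℝ} (hr : 0 < r) :
    (Integrable fun n => ⟪Kpi ψ r (kmul (kinv z) n), S n⟫) ∧
    Tvec (Kpi ψ r) S z = Tsc (Ktil ψ r)
      (fun n => ∑ i : Fin d, fderiv ℝ S n (0, 0, EuclideanSpace.single i 1) i) z := by
  obtain ⟨A, hA0, hA⟩ := S.exists_norm_le
  obtain ⟨A', hA0', hA'⟩ := S.exists_norm_fderiv_le
  have hcoord : ∀ (w : V d) i, |w i| ≤ ‖w‖ := fun w i => PiLp.norm_apply_le w i
  have hSm : ∀ i, Measurable fun n => S n i := fun i =>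
    ((EuclideanSpace.proj (𝕜 := ℝ) i).continuous.comp S.continuous).measurable
  have hDm : ∀ i : Fin d, Measurable fun n =>
      fderiv ℝ S n (0, 0, EuclideanSpace.single i 1) i := fun i =>
    ((EuclideanSpace.proj (𝕜 := ℝ) i).continuous.comp
      (S.continuous_fderiv.clm_apply continuous_const)).measurable
  have hSb : ∀ i n, |S n i| ≤ A := fun i n => (hcoord _ i).trans (hA n)
  have hDb : ∀ (i : Fin d) n, |fderiv ℝ S n (0, 0, EuclideanSpace.single i 1) i| ≤ A' :=
    fun i n => (hcoord _ i).trans (((fderiv ℝ S n).le_opNorm _).trans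
      (by rw [norm_snd_snd]; simpa using hA' n))
  have hK := fun i => integrable_Kpi_apply hψ (hSm i) (hSb i) z hr i
  have hT := fun i => (integral_Ktil hψ (hDm i) (hDb i) z hr).1
  have hT' := fun i => (integral_Ktil hψ (hSm i) (hSb i) z hr).1
  have hibp : ∀ i, ∫ n, Kpi ψ r (kmul (kinv z) n) i * S n i =
      ∫ n, Ktil ψ r (kmul (kinv z) n) * fderiv ℝ S n (0, 0, EuclideanSpace.single i 1) i := by
    intro i
    have hlS : ∀ n, HasLineDerivAt ℝ (fun n => S n i)
        (fderiv ℝ S n (0, 0, EuclideanSpace.single i 1) i) n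
        (0, 0, EuclideanSpace.single i 1) := fun n =>
      ((EuclideanSpace.proj (𝕜 := ℝ) i).hasFDerivAt.comp n
        (S.differentiableAt (x := n)).hasFDerivAt).hasLineDerivAt _
    have h := integral_bilinear_hasLineDerivAt_right_eq_neg_left_of_integrable
      (μ := volume) (B := ContinuousLinearMap.mul ℝ ℝ)
      (f := fun n => Ktil ψ r (kmul (kinv z) n)) (f' := fun n => -(Kpi ψ r (kmul (kinv z) n) i))
      (g := fun n => S n i) (g' := fun n => fderiv ℝ S n (0, 0, EuclideanSpace.single i 1) i)
      (v := (0, 0, EuclideanSpace.single i 1))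
      (by simpa using (hK i).neg) (by simpa using hT i) (by simpa using hT' i)
      (fun n _ => hasLineDerivAt_Ktil hψ z r i n) (fun n _ => hlS n)
    simp only [ContinuousLinearMap.mul_apply', neg_mul, integral_neg, neg_neg] at h
    exact h.symm
  have he : ∀ n, ⟪Kpi ψ r (kmul (kinv z) n), S n⟫ =
      ∑ i, Kpi ψ r (kmul (kinv z) n) i * S n i := fun n => by
    rw [PiLp.inner_apply]
    exact Finset.sum_congr rfl fun i _ => by simp [mul_comm]
  simp only [Tvec, Tsc, he, Finset.mul_sum]
  refine ⟨integrable_finsetSum _ fun i _ => hK i, ?_⟩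
  rw [integral_finsetSum _ fun i _ => hK i, integral_finsetSum _ fun i _ => hT i]
  exact Finset.sum_congr rfl fun i _ => hibp i

lemma hasDerivAt_sin_log {r : ℝ} (hr : 0 < r) :
    HasDerivAt (fun r => Real.sin (Real.log r)) (Real.cos (Real.log r) * r⁻¹) r :=
  (Real.hasDerivAt_log hr.ne').sin

lemma hasDerivAt_cos_log {r : ℝ} (hr : 0 < r) :
    HasDerivAt (fun r => Real.cos (Real.log r)) (-Real.sin (Real.log r) * r⁻¹) r :=
  (Real.hasDerivAt_log hr.ne').cos

lemma hasDerivAt_g1 {r : ℝ} (hr : 0 < r) : HasDerivAt g1 (2 * r * h1 r) r := by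
  refine ((hasDerivAt_pow 3 r).mul (hasDerivAt_sin_log hr)).congr_deriv ?_
  unfold h1
  field_simp
  push_cast
  ring

lemma hasDerivAt_g2 {r : ℝ} (hr : 0 < r) : HasDerivAt g2 (2 * r * h2 r) r := by
  refine ((hasDerivAt_pow 3 r).mul (hasDerivAt_cos_log hr)).congr_deriv ?_
  unfold h2
  field_simp
  push_cast
  ring

lemma hasDerivAt_h1 {r : ℝ} (hr : 0 < r) :
    HasDerivAt h1 (Real.sin (Real.log r) + 2 * Real.cos (Real.log r)) r := by
  refine (((hasDerivAt_id r).div_const 2).mul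
    (((hasDerivAt_sin_log hr).const_mul 3).add (hasDerivAt_cos_log hr))).congr_deriv ?_
  simp only [id]
  field_simp
  simp only [Pi.add_apply]
  ring

lemma hasDerivAt_h2 {r : ℝ} (hr : 0 < r) :
    HasDerivAt h2 (Real.cos (Real.log r) - 2 * Real.sin (Real.log r)) r := by
  refine (((hasDerivAt_id r).div_const 2).mul
    (((hasDerivAt_cos_log hr).const_mul 3).sub (hasDerivAt_sin_log hr))).congr_deriv ?_
  simp only [id]
  field_simp
  simp only [Pi.sub_apply]
  ring

lemma abs_deriv_h1_le {r : ℝ} (hr : 0 < r) : |deriv h1 r| ≤ 3 := by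
  rw [(hasDerivAt_h1 hr).deriv, abs_le]
  have := Real.neg_one_le_sin (Real.log r)
  have := Real.sin_le_one (Real.log r)
  have := Real.neg_one_le_cos (Real.log r)
  have := Real.cos_le_one (Real.log r)
  constructor <;> linarith

lemma abs_deriv_h2_le {r : ℝ} (hr : 0 < r) : |deriv h2 r| ≤ 3 := by
  rw [(hasDerivAt_h2 hr).deriv, abs_le]
  have := Real.neg_one_le_sin (Real.log r)
  have := Real.sin_le_one (Real.log r)
  have := Real.neg_one_le_cos (Real.log r)
  have := Real.cos_le_one (Real.log r)
  constructor <;> linarith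

lemma continuousAt_zero_pow_mul {n : ℕ} (hn : n ≠ 0) {b : ℝ → ℝ} {C : ℝ} (hb : ∀ r, |b r| ≤ C) :
    ContinuousAt (fun r => r ^ n * b r) 0 := by
  rw [ContinuousAt, zero_pow hn, zero_mul]
  have h : Filter.Tendsto (fun r : ℝ => |r| ^ n * C) (nhds 0) (nhds 0) := by
    have : Continuous fun r : ℝ => |r| ^ n * C := by fun_prop
    simpa [hn] using this.tendsto 0
  refine squeeze_zero_norm (fun r => ?_) h
  rw [Real.norm_eq_abs, abs_mul, abs_pow]
  gcongr
  exact hb r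

lemma continuousAt_g1_zero : ContinuousAt g1 0 :=
  continuousAt_zero_pow_mul (by norm_num) fun r => Real.abs_sin_le_one (Real.log r)

lemma continuousAt_g2_zero : ContinuousAt g2 0 :=
  continuousAt_zero_pow_mul (by norm_num) fun r => Real.abs_cos_le_one (Real.log r)

lemma continuousAt_h1_zero : ContinuousAt h1 0 := by
  have h := continuousAt_zero_pow_mul (n := 1) one_ne_zero (C := 2)
    (b := fun r => (3 * Real.sin (Real.log r) + Real.cos (Real.log r)) / 2) fun r => by
      have := Real.neg_one_le_sin (Real.log r)
      have := Real.sin_le_one (Real.log r)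
      have := Real.neg_one_le_cos (Real.log r)
      have := Real.cos_le_one (Real.log r)
      rw [abs_le]; constructor <;> linarith
  refine h.congr (Filter.Eventually.of_forall fun r => ?_)
  simp only [h1]; ring

lemma continuousAt_h2_zero : ContinuousAt h2 0 := by
  have h := continuousAt_zero_pow_mul (n := 1) one_ne_zero (C := 2)
    (b := fun r => (3 * Real.cos (Real.log r) - Real.sin (Real.log r)) / 2) fun r => by
      have := Real.neg_one_le_sin (Real.log r)
      have := Real.sin_le_one (Real.log r)
      have := Real.neg_one_le_cos (Real.log r)
      have := Real.cos_le_one (Real.log r)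
      rw [abs_le]; constructor <;> linarith
  refine h.congr (Filter.Eventually.of_forall fun r => ?_)
  simp only [h2]; ring

lemma continuousAt_ktraj {d : ℕ} (z m : Pt d) {r : ℝ} (h1c : ContinuousAt g1 r)
    (h2c : ContinuousAt g2 r) (h3c : ContinuousAt h1 r) (h4c : ContinuousAt h2 r) :
    ContinuousAt (fun r => ktraj z r m) r := by
  simp only [ktraj, kmul, kdil, blockMap_apply]
  fun_prop

lemma continuousOn_ktraj {d : ℕ} (z m : Pt d) :
    ContinuousOn (fun r => ktraj z r m) (Set.Ici 0) := by
  intro r hr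
  rcases eq_or_lt_of_le (Set.mem_Ici.mp hr) with rfl | hr
  · exact (continuousAt_ktraj z m continuousAt_g1_zero continuousAt_g2_zero
      continuousAt_h1_zero continuousAt_h2_zero).continuousWithinAt
  · exact (continuousAt_ktraj z m (hasDerivAt_g1 hr).continuousAt (hasDerivAt_g2 hr).continuousAt
      (hasDerivAt_h1 hr).continuousAt (hasDerivAt_h2 hr).continuousAt).continuousWithinAt

lemma ktraj_zero {d : ℕ} (z m : Pt d) : ktraj z 0 m = z := by
  simp [ktraj, kmul, kdil, blockMap_apply, g1, g2, h1, h2]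

lemma hasDerivAt_ktraj {d : ℕ} (z : Pt d) {m : Pt d} (hm : m.1 ≠ 0) {r : ℝ} (hr : 0 < r) :
    HasDerivAt (fun r => ktraj z r m)
      ((2 * m.1 * r) • ((1, (ktraj z r m).2.2, 0) : Pt d) +
        ((0, 0, F1 m.1 r • m.2.1 + F2 r • m.2.2) : Pt d)) r := by
  have d1 := hasDerivAt_g1 hr
  have d2 := hasDerivAt_g2 hr
  have d3 : HasDerivAt h1 (deriv h1 r) r := (hasDerivAt_h1 hr).differentiableAt.hasDerivAt
  have d4 : HasDerivAt h2 (deriv h2 r) r := (hasDerivAt_h2 hr).differentiableAt.hasDerivAt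
  have ds : HasDerivAt (fun r : ℝ => m.1 * r ^ 2) (m.1 * (2 * r)) r := by
    simpa using (hasDerivAt_pow 2 r).const_mul m.1
  have ht := ds.const_add z.1
  have hx := (((d1.smul_const m.2.1).add ((d2.const_mul m.1).smul_const m.2.2)).const_add
    z.2.1).add (ds.smul_const z.2.2)
  have hv := (((d3.div_const m.1).smul_const m.2.1).add (d4.smul_const m.2.2)).const_add z.2.2
  refine (ht.prodMk (hx.prodMk hv)).congr_deriv ?_
  refine Prod.ext ?_ (Prod.ext ?_ ?_)
  · simp; ring
  · simp only [ktraj, kmul, kdil, blockMap_apply, Prod.snd_add, Prod.fst_add, Prod.smul_snd,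
      Prod.smul_fst, add_zero, smul_add, smul_smul]
    have e : 2 * m.1 * r * (h1 r / m.1) = 2 * r * h1 r := by field_simp
    rw [e]
    module
  · simp [F1, F2, div_eq_inv_mul]

/-- The derivative of `r ↦ f(ktraj z r m)`. -/
def trajDeriv {d : ℕ} (f : Pt d → ℝ) (z : Pt d) (r : ℝ) (m : Pt d) : ℝ :=
  2 * m.1 * r * fderiv ℝ f (ktraj z r m) (1, (ktraj z r m).2.2, 0) +
    ⟪F1 m.1 r • m.2.1 + F2 r • m.2.2, gradV f (ktraj z r m)⟫

lemma hasDerivAt_comp_ktraj {d : ℕ} (f : SchwartzMap (Pt d) ℝ) (z : Pt d) {m : Pt d}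
    (hm : m.1 ≠ 0) {r : ℝ} (hr : 0 < r) :
    HasDerivAt (fun r => f (ktraj z r m)) (trajDeriv f z r m) r := by
  refine ((f.differentiableAt.hasFDerivAt.comp_hasDerivAt r
    (hasDerivAt_ktraj z hm hr))).congr_deriv ?_
  rw [map_add, map_smul, trajDeriv, inner_gradV, smul_eq_mul]

lemma continuous_transport {d : ℕ} (f : SchwartzMap (Pt d) ℝ) :
    Continuous fun w : Pt d => fderiv ℝ f w (1, w.2.2, 0) :=
  f.continuous_fderiv.clm_apply (by fun_prop)

lemma measurable_trajDeriv {d : ℕ} (f : SchwartzMap (Pt d) ℝ) (z : Pt d) :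
    Measurable fun p : ℝ × Pt d => trajDeriv f z p.1 p.2 := by
  have hγ := measurable_ktraj z
  have hgm := (continuous_gradV f.continuous_fderiv).measurable.comp hγ
  have hT := (continuous_transport f).measurable.comp hγ
  have hF1 : Measurable fun p : ℝ × Pt d => F1 p.2.1 p.1 := by
    unfold F1
    exact (measurable_const.div measurable_snd.fst).mul
      ((measurable_deriv h1).comp measurable_fst)
  have hF2 : Measurable fun p : ℝ × Pt d => F2 p.1 :=
    (measurable_deriv h2).comp measurable_fst
  have hv : Measurable fun p : ℝ × Pt d => F1 p.2.1 p.1 • p.2.2.1 + F2 p.1 • p.2.2.2 :=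
    (hF1.smul measurable_snd.snd.fst).add (hF2.smul measurable_snd.snd.snd)
  unfold trajDeriv
  exact (((measurable_const.mul measurable_snd.fst).mul measurable_fst).mul hT).add
    (hv.inner hgm)

lemma exists_trajDeriv_bound {d : ℕ} (f : SchwartzMap (Pt d) ℝ) {A : ℝ}
    (hA : ∀ w : Pt d, |fderiv ℝ f w (1, w.2.2, 0)| ≤ A) (z : Pt d) (τ : ℝ) :
    ∃ C, ∀ r ∈ Set.Ioo 0 τ, ∀ m ∈ bumpBox d, |trajDeriv f z r m| ≤ C := by
  obtain ⟨B, hB0, hB⟩ := f.exists_norm_fderiv_le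
  refine ⟨2 * 2 * τ * A + B * (3 + 3), fun r hr m hm => ?_⟩
  obtain ⟨-, h2, h3, h4, h5⟩ := mem_bumpBox hm
  refine (abs_add_le _ _).trans (add_le_add ?_ ?_)
  · rw [abs_mul, abs_mul, abs_mul, abs_two, abs_of_pos hr.1]
    have := hr.1
    have := hr.1.trans hr.2
    gcongr
    · exact hr.2.le
    · exact hA _
  · rw [inner_gradV]
    refine ((fderiv ℝ f _).le_opNorm _).trans ?_
    rw [norm_snd_snd]
    refine mul_le_mul (hB _) ((norm_add_le _ _).trans ?_) (norm_nonneg _) hB0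
    rw [norm_smul, norm_smul, F1, F2, Real.norm_eq_abs, abs_mul, one_div, Real.norm_eq_abs]
    have e1 : |m.1⁻¹| * |deriv h1 r| * ‖m.2.1‖ ≤ 1 * 3 * 1 := by
      gcongr
      exact abs_deriv_h1_le hr.1
    have e2 : |deriv _root_.h2 r| * ‖m.2.2‖ ≤ 3 * 1 := by
      gcongr
      exact abs_deriv_h2_le hr.1
    linarith

lemma integrable_bump_mul_trajDeriv {d : ℕ} {ψ : Pt d → ℝ} (hψ : IsKineticBump ψ)
    (f : SchwartzMap (Pt d) ℝ) {A : ℝ} (hA : ∀ w : Pt d, |fderiv ℝ f w (1, w.2.2, 0)| ≤ A)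
    (z : Pt d) (τ : ℝ) :
    Integrable (Function.uncurry fun r m => ψ m * trajDeriv f z r m)
      ((volume.restrict (Set.Ioo 0 τ)).prod volume) := by
  obtain ⟨C, hC⟩ := exists_trajDeriv_bound f hA z τ
  have hψi : Integrable ψ := hψ.smooth.continuous.integrable_of_hasCompactSupport
    hψ.hasCompactSupport
  have hbound := (integrable_const (μ := volume.restrict (Set.Ioo 0 τ)) C).mul_prod hψi
  refine hbound.mono' ?_ ?_
  · exact ((hψ.smooth.continuous.measurable.comp measurable_snd).mul
      (measurable_trajDeriv f z)).aestronglyMeasurable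
  · have hae : ∀ᵐ p ∂((volume.restrict (Set.Ioo 0 τ)).prod (volume : Measure (Pt d))),
        p.1 ∈ Set.Ioo 0 τ :=
      Measure.quasiMeasurePreserving_fst.ae (ae_restrict_mem measurableSet_Ioo)
    filter_upwards [hae] with p hp
    simp only [Function.uncurry]
    by_cases hm : p.2 ∈ bumpBox d
    · rw [norm_mul, Real.norm_of_nonneg (hψ.nonneg _), mul_comm C]
      exact mul_le_mul_of_nonneg_left (hC _ hp _ hm) (hψ.nonneg _)
    · simp [hψ.eq_zero hm]

lemma setIntegral_bump_mul_trajDeriv {d : ℕ} {ψ : Pt d → ℝ} (hψ : IsKineticBump ψ)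
    (f : SchwartzMap (Pt d) ℝ) {A : ℝ} (hA : ∀ w : Pt d, |fderiv ℝ f w (1, w.2.2, 0)| ≤ A)
    (z : Pt d) {τ : ℝ} (hτ : 0 < τ) (m : Pt d) :
    ∫ r in Set.Ioo 0 τ, ψ m * trajDeriv f z r m = ψ m * (f (ktraj z τ m) - f z) := by
  by_cases hm : m ∈ bumpBox d
  swap
  · simp [hψ.eq_zero hm]
  obtain ⟨C, hC⟩ := exists_trajDeriv_bound f hA z τ
  have hi : IntegrableOn (fun r => trajDeriv f z r m) (Set.Ioo 0 τ) :=
    IntegrableOn.of_bound measure_Ioo_lt_top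
      ((measurable_trajDeriv f z).comp measurable_prodMk_right).aestronglyMeasurable C
      ((ae_restrict_iff' measurableSet_Ioo).mpr
        (Filter.Eventually.of_forall fun r hr => hC r hr m hm))
  have h := intervalIntegral.integral_eq_sub_of_hasDerivAt_of_le hτ.le
    (f.continuous.comp_continuousOn ((continuousOn_ktraj z m).mono Set.Icc_subset_Ici_self))
    (fun r hr => hasDerivAt_comp_ktraj f z (mem_bumpBox hm).1 hr.1)
    ((intervalIntegrable_iff_integrableOn_Ioo_of_le hτ.le).mpr hi)
  rw [intervalIntegral.integral_of_le hτ.le, integral_Ioc_eq_integral_Ioo] at h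
  rw [integral_const_mul, h]
  simp [ktraj_zero]

/-- **Representation formula for the mollification defect (eq:repfTtauf).**
If `f ∈ 𝒮` satisfies `(∂_t + v·∇_x) f = ∇_v · S₀ + S₁` pointwise with `S₀, S₁` Schwartz,
then for every `τ > 0` and every `z`,
`f(z) − [T_{K_τ} f](z) = ∫₀^τ ([T_{K⃗^π_r} S₀](z) + [T_{K̃_r} S₁](z) + [T_{K⃗_r} ∇_v f](z)) dr`,
all integrals converging absolutely. -/
theorem statement6 (d : ℕ) (hd : 1 ≤ d) (ψ : Pt d → ℝ) (hψ : IsKineticBump ψ)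
    (f : SchwartzMap (Pt d) ℝ) (S0 : SchwartzMap (Pt d) (V d)) (S1 : SchwartzMap (Pt d) ℝ)
    (hpde : ∀ z : Pt d, fderiv ℝ (⇑f) z (1, z.2.2, 0) =
      (∑ i : Fin d, fderiv ℝ (⇑S0) z (0, 0, EuclideanSpace.single i 1) i) + S1 z)
    (τ : ℝ) (hτ : 0 < τ) (z : Pt d) :
    (Integrable fun m => Kker ψ τ (kmul (kinv z) m) * f m) ∧
    (∀ r ∈ Set.Ioo (0 : ℝ) τ,
      (Integrable fun m => ⟪Kpi ψ r (kmul (kinv z) m), S0 m⟫) ∧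
      (Integrable fun m => Ktil ψ r (kmul (kinv z) m) * S1 m) ∧
      (Integrable fun m => ⟪Kvec ψ r (kmul (kinv z) m), gradV (⇑f) m⟫)) ∧
    IntegrableOn (fun r => Tvec (Kpi ψ r) (⇑S0) z + Tsc (Ktil ψ r) (⇑S1) z +
      Tvec (Kvec ψ r) (gradV (⇑f)) z) (Set.Ioo (0 : ℝ) τ) ∧
    f z - Tsc (Kker ψ τ) (⇑f) z =
      ∫ r in Set.Ioo (0 : ℝ) τ,
        (Tvec (Kpi ψ r) (⇑S0) z + Tsc (Ktil ψ r) (⇑S1) z +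
          Tvec (Kvec ψ r) (gradV (⇑f)) z) := by
  have hdivm : Continuous fun n =>
      ∑ i : Fin d, fderiv ℝ (⇑S0) n (0, 0, EuclideanSpace.single i 1) i :=
    continuous_finsetSum _ fun i _ => (EuclideanSpace.proj (𝕜 := ℝ) i).continuous.comp
      (S0.continuous_fderiv.clm_apply continuous_const)
  obtain ⟨A0, -, hA0⟩ := S0.exists_norm_fderiv_le
  obtain ⟨A1, -, hA1⟩ := S1.exists_norm_le
  obtain ⟨Af, -, hAf⟩ := f.exists_norm_le
  have hdivb : ∀ n, |∑ i : Fin d, fderiv ℝ (⇑S0) n (0, 0, EuclideanSpace.single i 1) i| ≤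
      ∑ _i : Fin d, A0 := fun n =>
    (Finset.abs_sum_le_sum_abs _ _).trans (Finset.sum_le_sum fun i _ =>
      (PiLp.norm_apply_le _ i).trans (((fderiv ℝ S0 n).le_opNorm _).trans
        (by rw [norm_snd_snd]; simpa using hA0 n)))
  have hA : ∀ w : Pt d, |fderiv ℝ f w (1, w.2.2, 0)| ≤ ∑ _i : Fin d, A0 + A1 := fun w => by
    rw [hpde]
    exact (abs_add_le _ _).trans (add_le_add (hdivb w) (hA1 w))
  have hprod := integrable_bump_mul_trajDeriv hψ f hA z τ
  have hr_eq : ∀ r ∈ Set.Ioo (0 : ℝ) τ, Tvec (Kpi ψ r) (⇑S0) z + Tsc (Ktil ψ r) (⇑S1) z +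
      Tvec (Kvec ψ r) (gradV (⇑f)) z = -∫ m, ψ m * trajDeriv f z r m := by
    intro r hr
    have hγ : Measurable (ktraj z r) := (measurable_ktraj z).comp measurable_prodMk_left
    obtain ⟨i1, e1⟩ := integral_Ktil hψ S1.continuous.measurable hA1 z hr.1
    obtain ⟨i2, e2⟩ := integral_Ktil hψ hdivm.measurable hdivb z hr.1
    obtain ⟨-, e3⟩ := integral_Ktil hψ (continuous_transport f).measurable hA z hr.1
    have e4 := (integral_Kvec hψ f z hr.1).2
    have hsum : Tsc (Ktil ψ r) (fun n => ∑ i : Fin d,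
        fderiv ℝ (⇑S0) n (0, 0, EuclideanSpace.single i 1) i) z + Tsc (Ktil ψ r) (⇑S1) z =
        Tsc (Ktil ψ r) (fun w => fderiv ℝ f w (1, w.2.2, 0)) z := by
      rw [Tsc, Tsc, Tsc, ← integral_add i2 i1]
      refine integral_congr_ae (Filter.Eventually.of_forall fun n => ?_)
      simp only [hpde]
      ring
    have hFm : Measurable fun m : Pt d =>
        ⟪F1 m.1 r • m.2.1 + F2 r • m.2.2, gradV f (ktraj z r m)⟫ := by
      have hgm := (continuous_gradV f.continuous_fderiv).measurable
      have hF : Measurable fun s => F1 s r := by unfold F1; fun_prop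
      fun_prop
    have hTm := (continuous_transport f).measurable.comp hγ
    obtain ⟨C, hC⟩ := exists_trajDeriv_bound f hA z τ
    have j1 : Integrable fun m => ψ m *
        (-(2 * m.1 * r) * fderiv ℝ f (ktraj z r m) (1, (ktraj z r m).2.2, 0)) := by
      refine hψ.integrable_mul (C := 2 * 2 * r * (∑ _i : Fin d, A0 + A1)) ?_ fun m hm => ?_
      · exact (by fun_prop : Measurable fun m : Pt d => -(2 * m.1 * r)).mul hTm
      · obtain ⟨-, h2, -⟩ := mem_bumpBox hm
        have := hr.1
        rw [abs_mul, abs_neg, abs_mul, abs_mul, abs_two, abs_of_pos hr.1]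
        gcongr
        exact hA _
    have j : Integrable fun m => ψ m * trajDeriv f z r m :=
      hψ.integrable_mul ((measurable_trajDeriv f z).comp measurable_prodMk_left)
        fun m hm => hC r hr m hm
    have j2 : Integrable fun m => ψ m *
        -⟪F1 m.1 r • m.2.1 + F2 r • m.2.2, gradV f (ktraj z r m)⟫ := by
      refine (j.add j1).neg.congr (Filter.Eventually.of_forall fun m => ?_)
      simp only [Pi.add_apply, Pi.neg_apply, trajDeriv]
      ring
    rw [(integral_Kpi hψ S0 z hr.1).2, hsum, e3, e4, ← integral_add j1 j2, ← integral_neg]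
    refine integral_congr_ae (Filter.Eventually.of_forall fun m => ?_)
    simp only [trajDeriv]
    ring
  obtain ⟨k1, k2⟩ := integral_Kker hψ f.continuous.measurable hAf z hτ
  refine ⟨k1, fun r hr => ⟨(integral_Kpi hψ S0 z hr.1).1,
    (integral_Ktil hψ S1.continuous.measurable hA1 z hr.1).1, (integral_Kvec hψ f z hr.1).1⟩,
    ?_, ?_⟩
  · refine IntegrableOn.congr_fun hprod.integral_prod_left.neg (fun r hr => ?_) measurableSet_Ioo
    exact (hr_eq r hr).symm
  · rw [setIntegral_congr_fun measurableSet_Ioo hr_eq, integral_neg, integral_integral_swap hprod]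
    simp only [setIntegral_bump_mul_trajDeriv hψ f hA z hτ]
    have hγ : Measurable (ktraj z τ) := (measurable_ktraj z).comp measurable_prodMk_left
    have hψi : Integrable ψ := hψ.smooth.continuous.integrable_of_hasCompactSupport
      hψ.hasCompactSupport
    have hψf : Integrable fun m => ψ m * f (ktraj z τ m) :=
      hψ.integrable_mul (f.continuous.measurable.comp hγ) fun m _ => hAf _
    simp only [mul_sub]
    rw [integral_sub hψf (hψi.mul_const _), integral_mul_const, hψ.mass, k2]
    simp
end
end
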